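/- arXiv:1703.10244 — 2 statements merged into one kernel-verified Lean document; each statement's English description precedes it below -/
import Mathlib

section
/- Let A be a symmetric convex body in ℝⁿ and 1 ≤ k ≤ n. For a k×n real matrix T, let w(TA) = ∫_{S^{k−1}} h_{TA}(θ) dσ_k(θ) be the mean width of TA in ℝ^k. Then: (1) |w(TA) − w(SA)| ≤ (R(A)/√k)·‖T−S‖_HS for all k×n matrices T, S; and (2) there is an absolute constant (in fact one may take the bound exactly) such that if G is a k×n random matrix with i.i.d. standard Gaussian entries, then Var[w(GA)] ≤ min{R(A)²/k, Var[h_A(Z)]}, where Z ~ γ_n. -/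
open MeasureTheory ProbabilityTheory Real Set
open scoped Matrix RealInnerProductSpace

/-- The standard Gaussian probability measure `γ_n` on `ℝⁿ`. -/
noncomputable def stdGaussian (n : ℕ) : Measure (EuclideanSpace ℝ (Fin n)) :=
  (Measure.pi fun _ : Fin n => gaussianReal 0 1).map (EuclideanSpace.equiv (Fin n) ℝ).symm

/-- The law of a `k × n` random matrix with i.i.d. standard Gaussian entries. -/
noncomputable def stdGaussianMatrix (k n : ℕ) : Measure (Fin k → Fin n → ℝ) :=
  Measure.pi fun _ : Fin k => Measure.pi fun _ : Fin n => gaussianReal 0 1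

/-- The rotation-invariant (uniform) probability measure `σ_k` on the Euclidean unit
sphere `S^{k−1}`, viewed as a measure on `ℝ^k` supported on the sphere. -/
noncomputable def uniformSphere (k : ℕ) : Measure (EuclideanSpace ℝ (Fin k)) :=
  (((volume : Measure (EuclideanSpace ℝ (Fin k))).toSphere Set.univ)⁻¹ •
    (volume : Measure (EuclideanSpace ℝ (Fin k))).toSphere).map Subtype.val

/-- The support function `h_S(x) = max_{a ∈ S} ⟨a, x⟩`. -/
noncomputable def suppFn {k : ℕ} (S : Set (EuclideanSpace ℝ (Fin k)))
    (x : EuclideanSpace ℝ (Fin k)) : ℝ :=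
  sSup ((fun a => ⟪a, x⟫) '' S)

/-- The mean width `w(S) = ∫_{S^{k−1}} h_S(θ) dσ_k(θ)` of a set `S ⊆ ℝ^k`. -/
noncomputable def meanWidth {k : ℕ} (S : Set (EuclideanSpace ℝ (Fin k))) : ℝ :=
  ∫ θ, suppFn S θ ∂uniformSphere k

/-- The circumradius `R(A) = max_{x ∈ A} ‖x‖₂`. -/
noncomputable def circumradius {n : ℕ} (A : Set (EuclideanSpace ℝ (Fin n))) : ℝ :=
  sSup ((fun x => ‖x‖) '' A)

/-- The Hilbert–Schmidt (Frobenius) norm of a matrix. -/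
noncomputable def hsNorm {k n : ℕ} (T : Matrix (Fin k) (Fin n) ℝ) : ℝ :=
  Real.sqrt (∑ i, ∑ j, T i j ^ 2)

lemma mw_prod_key {X Y : Type*} [MeasurableSpace X] [MeasurableSpace Y]
    (μ : Measure X) (ν : Measure Y) [IsProbabilityMeasure μ] [IsProbabilityMeasure ν]
    (F : X × Y → ℝ) (hF : MemLp F 2 (μ.prod ν)) : MemLp (fun x => ∫ y, F (x, y) ∂ν) 2 μ := by
  have hFi : Integrable F (μ.prod ν) := hF.integrable (by norm_num)
  have hF2 : Integrable (fun z => F z ^ 2) (μ.prod ν) := hF.integrable_sq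
  have hm : AEStronglyMeasurable (fun x => ∫ y, F (x, y) ∂ν) μ :=
    hFi.integral_prod_left.aestronglyMeasurable
  rw [memLp_two_iff_integrable_sq hm]
  refine Integrable.mono' hF2.integral_prod_left (hm.pow 2) ?_
  filter_upwards [hFi.prod_right_ae, hF2.prod_right_ae,
    hF.1.prodMk_left] with x h1 h2 h3
  have : MemLp (fun y => F (x, y)) 2 ν := (memLp_two_iff_integrable_sq h3).2 h2
  have h4 := variance_nonneg (fun y => F (x, y)) ν
  rw [variance_eq_sub this] at h4
  simp only [Pi.pow_apply] at h4
  rw [Real.norm_of_nonneg (by positivity)]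
  linarith

/-- L² inequality for conditional means on a product space. -/
lemma mw_prod_ineq {X Y : Type*} [MeasurableSpace X] [MeasurableSpace Y]
    (μ : Measure X) (ν : Measure Y) [IsProbabilityMeasure μ] [IsProbabilityMeasure ν]
    (F : X × Y → ℝ) (hF : MemLp F 2 (μ.prod ν)) :
    MemLp (fun x => ∫ y, F (x, y) ∂ν) 2 μ ∧ MemLp (fun y => ∫ x, F (x, y) ∂μ) 2 ν ∧
    ∫ x, (∫ y, F (x, y) ∂ν) ^ 2 ∂μ + ∫ y, (∫ x, F (x, y) ∂μ) ^ 2 ∂ν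
      ≤ ∫ z, F z ^ 2 ∂(μ.prod ν) + (∫ z, F z ∂(μ.prod ν)) ^ 2 := by
  have hFi : Integrable F (μ.prod ν) := hF.integrable (by norm_num)
  have hF2 : Integrable (fun z => F z ^ 2) (μ.prod ν) := hF.integrable_sq
  have ha := mw_prod_key μ ν F hF
  have hb : MemLp (fun y => ∫ x, F (x, y) ∂μ) 2 ν := by
    have := mw_prod_key ν μ (F ∘ Prod.swap) (hF.comp_measurePreserving Measure.measurePreserving_swap)
    simpa using this
  refine ⟨ha, hb, ?_⟩
  set a := fun x => ∫ y, F (x, y) ∂ν with hadef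
  set b := fun y => ∫ x, F (x, y) ∂μ with hbdef
  set m := ∫ z, F z ∂(μ.prod ν) with hm
  have ha' : MemLp (fun z : X × Y => a z.1) 2 (μ.prod ν) :=
    ha.comp_measurePreserving measurePreserving_fst
  have hb' : MemLp (fun z : X × Y => b z.2) 2 (μ.prod ν) :=
    hb.comp_measurePreserving measurePreserving_snd
  have hma : ∫ x, a x ∂μ = m := (integral_prod F hFi).symm
  have hmb : ∫ y, b y ∂ν = m := (integral_prod_symm F hFi).symm
  have i1 : Integrable (fun z : X × Y => F z * a z.1) (μ.prod ν) := hF.integrable_mul ha'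
  have i2 : Integrable (fun z : X × Y => F z * b z.2) (μ.prod ν) := hF.integrable_mul hb'
  have i3 : Integrable (fun z : X × Y => a z.1 * b z.2) (μ.prod ν) := ha'.integrable_mul hb'
  have i4 : Integrable (fun z : X × Y => a z.1) (μ.prod ν) := ha'.integrable (by norm_num)
  have i5 : Integrable (fun z : X × Y => b z.2) (μ.prod ν) := hb'.integrable (by norm_num)
  have i6 : Integrable (fun z : X × Y => a z.1 ^ 2) (μ.prod ν) := ha'.integrable_sq
  have i7 : Integrable (fun z : X × Y => b z.2 ^ 2) (μ.prod ν) := hb'.integrable_sq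
  have e1 : ∫ z : X × Y, F z * a z.1 ∂(μ.prod ν) = ∫ x, a x ^ 2 ∂μ := by
    rw [integral_prod _ i1]
    simp only [integral_mul_const]
    simp [hadef, sq]
  have e2 : ∫ z : X × Y, F z * b z.2 ∂(μ.prod ν) = ∫ x, b x ^ 2 ∂ν := by
    rw [integral_prod_symm _ i2]
    simp only [integral_mul_const]
    simp [hbdef, sq]
  have e3 : ∫ z : X × Y, a z.1 * b z.2 ∂(μ.prod ν) = m * m := by
    rw [integral_prod_mul, hma, hmb]
  have e4 : ∫ z : X × Y, a z.1 ∂(μ.prod ν) = m := by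
    rw [integral_fun_fst]; simp [hma]
  have e5 : ∫ z : X × Y, b z.2 ∂(μ.prod ν) = m := by
    rw [integral_fun_snd]; simp [hmb]
  have e6 : ∫ z : X × Y, a z.1 ^ 2 ∂(μ.prod ν) = ∫ x, a x ^ 2 ∂μ := by
    rw [integral_fun_fst (fun x => a x ^ 2)]; simp
  have e7 : ∫ z : X × Y, b z.2 ^ 2 ∂(μ.prod ν) = ∫ x, b x ^ 2 ∂ν := by
    rw [integral_fun_snd (fun x => b x ^ 2)]; simp
  have h0 : 0 ≤ ∫ z : X × Y, (F z - a z.1 - b z.2 + m) ^ 2 ∂(μ.prod ν) :=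
    integral_nonneg fun _ => sq_nonneg _
  have hexp : (fun z : X × Y => (F z - a z.1 - b z.2 + m) ^ 2) = fun z =>
      F z ^ 2 + (a z.1 ^ 2 + (b z.2 ^ 2 + (m ^ 2 + ((-2) * (F z * a z.1) + ((-2) * (F z * b z.2)
        + ((2 * m) * F z + (2 * (a z.1 * b z.2) + ((-2 * m) * a z.1 + (-2 * m) * b z.2)))))))) := by
    funext z; ring
  have j9 := (i4.const_mul (-2 * m)).fun_add (i5.const_mul (-2 * m))
  have j8 := (i3.const_mul 2).fun_add j9
  have j7 := (hFi.const_mul (2 * m)).fun_add j8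
  have j6 := (i2.const_mul (-2)).fun_add j7
  have j5 := (i1.const_mul (-2)).fun_add j6
  have j4 := (integrable_const (μ := μ.prod ν) (m ^ 2)).fun_add j5
  have j3 := i7.fun_add j4
  have j2 := i6.fun_add j3
  rw [hexp, integral_add hF2 j2, integral_add i6 j3, integral_add i7 j4,
    integral_add (integrable_const _) j5, integral_add (i1.const_mul _) j6,
    integral_add (i2.const_mul _) j7, integral_add (hFi.const_mul _) j8,
    integral_add (i3.const_mul _) j9, integral_add (i4.const_mul _) (i5.const_mul _)] at h0
  simp only [integral_const_mul, e1, e2, e3, e4, e5, e6, e7, integral_const, ← hm] at h0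
  simp at h0
  nlinarith

lemma mw_var_prod_aux {X Y : Type*} [MeasurableSpace X] [MeasurableSpace Y]
    (μ : Measure X) (ν : Measure Y) [IsProbabilityMeasure μ] [IsProbabilityMeasure ν]
    (F : X × Y → ℝ) (hF : MemLp F 2 (μ.prod ν)) :
    Integrable (fun y => variance (fun x => F (x, y)) μ) ν ∧
    ∫ y, variance (fun x => F (x, y)) μ ∂ν =
      ∫ z, F z ^ 2 ∂(μ.prod ν) - ∫ y, (∫ x, F (x, y) ∂μ) ^ 2 ∂ν := by
  have hF2 : Integrable (fun z => F z ^ 2) (μ.prod ν) := hF.integrable_sq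
  obtain ⟨ha, hb, _⟩ := mw_prod_ineq μ ν F hF
  have hG : MemLp (F ∘ Prod.swap) 2 (ν.prod μ) :=
    hF.comp_measurePreserving Measure.measurePreserving_swap
  have hae : (fun y => variance (fun x => F (x, y)) μ) =ᵐ[ν]
      fun y => ∫ x, F (x, y) ^ 2 ∂μ - (∫ x, F (x, y) ∂μ) ^ 2 := by
    filter_upwards [hG.integrable_sq.prod_right_ae, hG.1.prodMk_left] with y h2 h3
    have : MemLp (fun x => F (x, y)) 2 μ := (memLp_two_iff_integrable_sq h3).2 h2
    rw [variance_eq_sub this]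
    simp
  have I : Integrable (fun y => ∫ x, F (x, y) ^ 2 ∂μ - (∫ x, F (x, y) ∂μ) ^ 2) ν :=
    hF2.integral_prod_right.sub hb.integrable_sq
  refine ⟨I.congr hae.symm, ?_⟩
  rw [integral_congr_ae hae, integral_sub hF2.integral_prod_right hb.integrable_sq,
    integral_prod_symm _ hF2]

/-- Variance of an average is at most the average of the variances. -/
lemma mw_var_avg {X Y : Type*} [MeasurableSpace X] [MeasurableSpace Y]
    (μ : Measure X) (ν : Measure Y) [IsProbabilityMeasure μ] [IsProbabilityMeasure ν]
    (F : X × Y → ℝ) (hF : MemLp F 2 (μ.prod ν)) :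
    variance (fun x => ∫ y, F (x, y) ∂ν) μ ≤ ∫ y, variance (fun x => F (x, y)) μ ∂ν := by
  obtain ⟨ha, hb, h⟩ := mw_prod_ineq μ ν F hF
  rw [(mw_var_prod_aux μ ν F hF).2, variance_eq_sub ha]
  rw [integral_prod F (hF.integrable (by norm_num))] at h
  simp only [Pi.pow_apply]
  linarith

/-- Subadditivity of the variance. -/
lemma mw_var_sub {X Y : Type*} [MeasurableSpace X] [MeasurableSpace Y]
    (μ : Measure X) (ν : Measure Y) [IsProbabilityMeasure μ] [IsProbabilityMeasure ν]
    (F : X × Y → ℝ) (hF : MemLp F 2 (μ.prod ν)) :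
    variance F (μ.prod ν) ≤ ∫ y, variance (fun x => F (x, y)) μ ∂ν
      + ∫ x, variance (fun y => F (x, y)) ν ∂μ := by
  obtain ⟨ha, hb, h⟩ := mw_prod_ineq μ ν F hF
  have hG : MemLp (F ∘ Prod.swap) 2 (ν.prod μ) :=
    hF.comp_measurePreserving Measure.measurePreserving_swap
  have h2 := (mw_var_prod_aux ν μ (F ∘ Prod.swap) hG).2
  have h3 : ∫ z, (F ∘ Prod.swap) z ^ 2 ∂(ν.prod μ) = ∫ z, F z ^ 2 ∂(μ.prod ν) :=
    integral_prod_swap (fun z => F z ^ 2)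
  rw [h3] at h2
  simp only [Function.comp, Prod.swap_prod_mk] at h2
  rw [(mw_var_prod_aux μ ν F hF).2, h2, variance_eq_sub hF]
  simp only [Pi.pow_apply]
  linarith

lemma mw_lip_memLp {E : Type*} [NormedAddCommGroup E] [MeasurableSpace E] [BorelSpace E]
    [SecondCountableTopology E]
    (μ : Measure E) [IsProbabilityMeasure μ] (hμ : MemLp id 2 μ) {f : E → ℝ} {K : NNReal}
    (hf : LipschitzWith K f) : MemLp f 2 μ := by
  have h0 : MemLp (fun x : E => ‖x‖) 2 μ := hμ.norm
  have h0' : MemLp (fun x : E => (K : ℝ) * ‖x‖) 2 μ := h0.const_mul _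
  have h1 : MemLp (fun x : E => |f 0| + K * ‖x‖) 2 μ := (memLp_const (|f 0|)).add h0'
  refine h1.mono hf.continuous.aestronglyMeasurable (Filter.Eventually.of_forall fun x => ?_)
  have := hf.dist_le_mul x 0
  rw [dist_zero_right, Real.dist_eq] at this
  rw [Real.norm_eq_abs, Real.norm_of_nonneg (by positivity)]
  have h3 : |f x| ≤ |f x - f 0| + |f 0| := by simpa using abs_add_le (f x - f 0) (f 0)
  linarith

lemma mw_double_cov {X : Type*} [MeasurableSpace X] (μ : Measure X) [IsProbabilityMeasure μ]
    {u v : X → ℝ} (hu : MemLp u 2 μ) (hv : MemLp v 2 μ) :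
    Integrable (fun z : X × X => (u z.1 - u z.2) * (v z.1 - v z.2)) (μ.prod μ) ∧
    ∫ z : X × X, (u z.1 - u z.2) * (v z.1 - v z.2) ∂(μ.prod μ) =
      2 * ∫ x, u x * v x ∂μ - 2 * ((∫ x, u x ∂μ) * ∫ x, v x ∂μ) := by
  have huv : Integrable (fun x => u x * v x) μ := hu.integrable_mul hv
  have hui := hu.integrable (by norm_num)
  have hvi := hv.integrable (by norm_num)
  have i1 : Integrable (fun z : X × X => u z.1 * v z.1) (μ.prod μ) := huv.comp_fst μ
  have i2 : Integrable (fun z : X × X => u z.2 * v z.2) (μ.prod μ) := huv.comp_snd μ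
  have i3 : Integrable (fun z : X × X => u z.1 * v z.2) (μ.prod μ) := hui.mul_prod hvi
  have i4 : Integrable (fun z : X × X => v z.1 * u z.2) (μ.prod μ) := hvi.mul_prod hui
  have hexp : (fun z : X × X => (u z.1 - u z.2) * (v z.1 - v z.2)) =
      fun z => (u z.1 * v z.1 + u z.2 * v z.2) - (u z.1 * v z.2 + v z.1 * u z.2) := by
    funext z; ring
  rw [hexp]
  refine ⟨(i1.add i2).sub (i3.add i4), ?_⟩
  rw [integral_sub (i1.fun_add i2) (i3.fun_add i4), integral_add i1 i2, integral_add i3 i4,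
    integral_prod_mul, integral_prod_mul, integral_fun_fst (fun x => u x * v x),
    integral_fun_snd (fun x => u x * v x)]
  simp
  ring

lemma mw_hasDerivAt_pdf (x : ℝ) :
    HasDerivAt (gaussianPDFReal 0 1) (-x * gaussianPDFReal 0 1 x) x := by
  have h1 : gaussianPDFReal 0 1 = fun x => (√(2 * π))⁻¹ * rexp (-x ^ 2 / 2) := by
    funext y; simp [gaussianPDFReal]
  rw [h1]
  have h2 : HasDerivAt (fun x : ℝ => -x ^ 2 / 2) (-x) x := by
    have := ((hasDerivAt_pow 2 x).fun_neg).div_const 2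
    refine this.congr_deriv ?_
    simp
    ring
  refine ((h2.exp).const_mul (√(2 * π))⁻¹).congr_deriv ?_
  ring

lemma mw_gauss_integrable {g : ℝ → ℝ} (hg : Integrable g (gaussianReal 0 1)) :
    Integrable (fun x => gaussianPDFReal 0 1 x * g x) := by
  rw [gaussianReal_of_var_ne_zero 0 one_ne_zero] at hg
  have := (integrable_withDensity_iff_integrable_smul' (measurable_gaussianPDF 0 1)
    (Filter.Eventually.of_forall fun x => gaussianPDF_lt_top)).1 hg
  simpa [toReal_gaussianPDF] using this

open Filter Topology in
lemma mw_boundary {f : ℝ → ℝ} {K : NNReal} (hf : LipschitzWith K f) :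
    Tendsto (fun x => f x * gaussianPDFReal 0 1 x) (cocompact ℝ) (𝓝 0) := by
  have t0 := tendsto_rpow_abs_mul_exp_neg_mul_sq_cocompact (a := 1/2) (by norm_num) 0
  have t1 := tendsto_rpow_abs_mul_exp_neg_mul_sq_cocompact (a := 1/2) (by norm_num) 1
  have t := ((t0.const_mul |f 0|).add (t1.const_mul (K:ℝ))).const_mul (√(2 * π))⁻¹
  simp only [mul_zero, add_zero] at t
  refine squeeze_zero_norm (fun x => ?_) t
  have h1 : gaussianPDFReal 0 1 x = (√(2 * π))⁻¹ * rexp (-(1/2) * x ^ 2) := by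
    simp [gaussianPDFReal]; left; ring
  have := hf.dist_le_mul x 0
  rw [dist_zero_right, Real.dist_eq, Real.norm_eq_abs] at this
  have h3 : |f x| ≤ |f x - f 0| + |f 0| := by simpa using abs_add_le (f x - f 0) (f 0)
  rw [norm_mul, Real.norm_eq_abs, Real.norm_of_nonneg (gaussianPDFReal_nonneg 0 1 x), h1]
  simp only [rpow_zero, rpow_one]
  have h4 : (0:ℝ) ≤ (√(2 * π))⁻¹ * rexp (-(1/2) * x ^ 2) := by positivity
  calc |f x| * ((√(2 * π))⁻¹ * rexp (-(1/2) * x ^ 2))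
      ≤ (K * |x| + |f 0|) * ((√(2 * π))⁻¹ * rexp (-(1/2) * x ^ 2)) := by gcongr; linarith
    _ = _ := by ring

open Filter Topology in
lemma mw_stein {f : ℝ → ℝ} {K : NNReal} (hf : LipschitzWith K f) :
    ∫ x, x * f x ∂(gaussianReal 0 1) = ∫ x, deriv f x ∂(gaussianReal 0 1) := by
  have hid : MemLp (id : ℝ → ℝ) 2 (gaussianReal 0 1) := memLp_id_gaussianReal 2
  have i1 : Integrable (fun x => x * f x) (gaussianReal 0 1) :=
    hid.integrable_mul (mw_lip_memLp _ hid hf)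
  have i2 : Integrable (deriv f) (gaussianReal 0 1) :=
    Integrable.of_bound (measurable_deriv f).aestronglyMeasurable K
      (Eventually.of_forall fun x => norm_deriv_le_of_lipschitz hf)
  have j1 := mw_gauss_integrable i1
  have j2 := mw_gauss_integrable i2
  have e : ∀ N : ℕ, ∫ x in (-(N:ℝ))..N, (gaussianPDFReal 0 1 x * deriv f x
      - gaussianPDFReal 0 1 x * (x * f x)) =
      f N * gaussianPDFReal 0 1 N - f (-N) * gaussianPDFReal 0 1 (-N) := by
    intro N
    have a1 : AbsolutelyContinuousOnInterval f (-(N:ℝ)) N :=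
      (hf.lipschitzOnWith).absolutelyContinuousOnInterval
    have a2 : AbsolutelyContinuousOnInterval (gaussianPDFReal 0 1) (-(N:ℝ)) N := by
      apply ContDiffOn.absolutelyContinuousOnInterval
      apply ContDiff.contDiffOn
      unfold gaussianPDFReal
      fun_prop
    rw [← a1.integral_deriv_mul_eq_sub a2]
    congr 1; funext x
    rw [(mw_hasDerivAt_pdf x).deriv]; ring
  have tN : Tendsto (fun N : ℕ => (N:ℝ)) atTop atTop := tendsto_natCast_atTop_atTop
  have tN' : Tendsto (fun N : ℕ => -(N:ℝ)) atTop atBot := tendsto_neg_atTop_atBot.comp tN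
  have l1 := intervalIntegral_tendsto_integral (j2.sub j1) tN' tN
  have l2 : Tendsto (fun N : ℕ => f N * gaussianPDFReal 0 1 N
      - f (-N) * gaussianPDFReal 0 1 (-N)) atTop (𝓝 (0 - 0)) := by
    refine Tendsto.sub ?_ ?_
    · exact (mw_boundary hf).comp (tN.mono_right atTop_le_cocompact)
    · exact (mw_boundary hf).comp (tN'.mono_right atBot_le_cocompact)
  have := tendsto_nhds_unique (l1.congr e) l2
  simp only [Pi.sub_apply] at this
  rw [integral_sub j2 j1] at this
  rw [integral_gaussianReal_eq_integral_smul one_ne_zero,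
    integral_gaussianReal_eq_integral_smul one_ne_zero]
  simp only [smul_eq_mul]
  linarith

lemma mw_cs {g : ℝ → ℝ} {y x : ℝ} (hyx : y ≤ x) (hg : IntervalIntegrable g volume y x)
    (hg2 : IntervalIntegrable (fun t => g t ^ 2) volume y x) :
    (∫ t in y..x, g t) ^ 2 ≤ (x - y) * ∫ t in y..x, g t ^ 2 := by
  rcases hyx.eq_or_lt with rfl | h
  · simp
  set I := ∫ t in y..x, g t
  have hxy : 0 < x - y := sub_pos.2 h
  have h0 : 0 ≤ ∫ t in y..x, (((x - y) ^ 2 * g t ^ 2 - (2 * (x - y) * I) * g t) + I ^ 2) := by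
    apply intervalIntegral.integral_nonneg hyx
    intro t _
    nlinarith [sq_nonneg ((x - y) * g t - I)]
  rw [intervalIntegral.integral_add ((hg2.const_mul _).sub (hg.const_mul _)) (by simp),
    intervalIntegral.integral_sub (hg2.const_mul _) (hg.const_mul _),
    intervalIntegral.integral_const_mul, intervalIntegral.integral_const_mul,
    intervalIntegral.integral_const] at h0
  have : 0 ≤ (x - y) * ((x - y) * (∫ t in y..x, g t ^ 2) - I ^ 2) := by
    simp only [smul_eq_mul] at h0
    change 0 ≤ (x - y) ^ 2 * _ - 2 * (x - y) * I * I + _ at h0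
    nlinarith
  have := nonneg_of_mul_nonneg_right this hxy
  linarith

/-- Sharp one-dimensional Gaussian Poincaré inequality for Lipschitz functions. -/
lemma mw_poincare_one {f : ℝ → ℝ} {K : NNReal} (hf : LipschitzWith K f) :
    variance f (gaussianReal 0 1) ≤ ∫ x, deriv f x ^ 2 ∂(gaussianReal 0 1) := by
  have hid : MemLp (id : ℝ → ℝ) 2 (gaussianReal 0 1) := memLp_id_gaussianReal 2
  have hb : ∀ x, ‖deriv f x ^ 2‖ ≤ ((K ^ 2 : NNReal) : ℝ) := by
    intro x
    rw [norm_pow]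
    push_cast
    have := norm_deriv_le_of_lipschitz (x₀ := x) hf
    gcongr
  have hm : Measurable (fun x => deriv f x ^ 2) := (measurable_deriv f).pow_const 2
  have ii : ∀ a b, IntervalIntegrable (fun x => deriv f x ^ 2) volume a b := fun a b =>
    (intervalIntegrable_const (c := ((K ^ 2 : NNReal) : ℝ))).mono_fun hm.aestronglyMeasurable
      (Filter.Eventually.of_forall fun x => by simpa using hb x)
  set F : ℝ → ℝ := fun x => ∫ t in (0:ℝ)..x, deriv f t ^ 2 with hF
  have hsub : ∀ x y, F x - F y = ∫ t in y..x, deriv f t ^ 2 := fun x y =>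
    intervalIntegral.integral_interval_sub_left (ii _ _) (ii _ _)
  have hFl : LipschitzWith (K ^ 2) F := by
    refine LipschitzWith.of_dist_le_mul fun x y => ?_
    rw [Real.dist_eq, Real.dist_eq, hsub, ← Real.norm_eq_abs]
    exact intervalIntegral.norm_integral_le_of_norm_le_const fun t _ => hb t
  have hFd : ∀ᵐ x, deriv F x = deriv f x ^ 2 := by
    have : LocallyIntegrable (fun x => deriv f x ^ 2) volume := by
      refine (locallyIntegrable_const ((K ^ 2 : NNReal) : ℝ)).mono hm.aestronglyMeasurable
        (Filter.Eventually.of_forall fun x => by simpa using hb x)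
    filter_upwards [LocallyIntegrable.ae_hasDerivAt_integral this] with x hx
    exact (hx 0).deriv
  have key : ∀ x y, (f x - f y) * (f x - f y) ≤ (x - y) * (F x - F y) := by
    have : ∀ x y, y ≤ x → (f x - f y) * (f x - f y) ≤ (x - y) * (F x - F y) := by
      intro x y h
      have a1 : AbsolutelyContinuousOnInterval f y x :=
        (hf.lipschitzOnWith).absolutelyContinuousOnInterval
      rw [← sq, hsub, ← a1.integral_deriv_eq_sub]
      exact mw_cs h a1.intervalIntegrable_deriv (ii _ _)
    intro x y
    rcases le_total y x with h | h
    · exact this x y h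
    · have := this y x h; linarith
  have hfL := mw_lip_memLp _ hid hf
  have hFL := mw_lip_memLp _ hid hFl
  obtain ⟨i1, e1⟩ := mw_double_cov (gaussianReal 0 1) hfL hfL
  obtain ⟨i2, e2⟩ := mw_double_cov (gaussianReal 0 1) hid hFL
  have hle := integral_mono i1 i2 (fun z => key z.1 z.2)
  rw [e1, e2] at hle
  have hac := gaussianReal_absolutelyContinuous 0 (v := 1) one_ne_zero
  have st := mw_stein hFl
  rw [integral_congr_ae (hac.ae_le hFd)] at st
  rw [variance_eq_sub hfL, ← st]
  simp only [id, integral_id_gaussianReal, zero_mul, mul_zero, sub_zero] at hle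
  simp only [Pi.pow_apply, sq]
  linarith

/-- Poincaré inequality for Lipschitz functions along a finite family of directions. -/
def mwPoinc {E : Type*} [NormedAddCommGroup E] [NormedSpace ℝ E] [MeasurableSpace E]
    (μ : Measure E) {ι : Type*} [Fintype ι] (B : ι → E) : Prop :=
  ∀ (f : E → ℝ) (K : NNReal), LipschitzWith K f →
    variance f μ ≤ ∫ x, ∑ i, (lineDeriv ℝ f x (B i)) ^ 2 ∂μ

lemma mwPoinc_real : mwPoinc (gaussianReal 0 1) (fun _ : Unit => (1 : ℝ)) := by
  intro f K hf
  have := mw_poincare_one hf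
  have e : ∀ x, lineDeriv ℝ f x 1 = deriv f x := by
    intro x
    unfold lineDeriv
    have := deriv_comp_const_add (𝕜 := ℝ) f x 0
    simpa using this
  simpa [e] using this

lemma mw_memLp_pi {E : Type*} [NormedAddCommGroup E] [MeasurableSpace E] [BorelSpace E]
    (μ : Measure E) [IsProbabilityMeasure μ] (hμ : MemLp id 2 μ) (m : ℕ) :
    MemLp id 2 (Measure.pi fun _ : Fin m => μ) := by
  rw [memLp_pi_iff]
  intro i
  exact hμ.comp_measurePreserving (measurePreserving_eval (fun _ : Fin m => μ) i)

lemma mw_lineDeriv_sq {E : Type*} [NormedAddCommGroup E] [NormedSpace ℝ E] [MeasurableSpace E]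
    [BorelSpace E] [SecondCountableTopology E] [FiniteDimensional ℝ E]
    (μ : Measure E) [IsProbabilityMeasure μ] {f : E → ℝ} {K : NNReal} (hf : LipschitzWith K f)
    (v : E) : Integrable (fun x => (lineDeriv ℝ f x v) ^ 2) μ := by
  refine Integrable.of_bound
    ((measurable_lineDeriv hf.continuous).pow_const 2).aestronglyMeasurable ((K * ‖v‖) ^ 2)
    (Filter.Eventually.of_forall fun x => ?_)
  rw [norm_pow]
  gcongr
  exact norm_lineDeriv_le_of_lipschitz ℝ hf

lemma mwPoinc_pi {E : Type} [NormedAddCommGroup E] [NormedSpace ℝ E] [MeasurableSpace E]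
    [BorelSpace E] [SecondCountableTopology E] [FiniteDimensional ℝ E]
    (μ : Measure E) [IsProbabilityMeasure μ] (hμ : MemLp id 2 μ)
    {ι : Type*} [Fintype ι] (B : ι → E) (hB : mwPoinc μ B) (m : ℕ) :
    mwPoinc (Measure.pi fun _ : Fin m => μ)
      (fun p : Fin m × ι => (Pi.single p.1 (B p.2) : Fin m → E)) := by
  induction m with
  | zero =>
    intro f K hf
    have : f = fun _ => f 0 := by funext x; congr 1; exact Subsingleton.elim _ _
    rw [this]
    simp [variance_eq_integral]
  | succ m ih =>
    intro f K hf
    set ν := Measure.pi fun _ : Fin m => μ with hν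
    have mp := (measurePreserving_piFinSuccAbove (fun _ : Fin (m + 1) => μ) 0).symm
    have hc : ∀ z : E × (Fin m → E),
        (MeasurableEquiv.piFinSuccAbove (fun _ : Fin (m + 1) => E) 0).symm z
          = Fin.cons z.1 z.2 := by
      intro z
      exact Fin.insertNth_zero' (β := E) z.1 z.2
    have hdist : ∀ (x x' : E) (y y' : Fin m → E),
        dist (Fin.cons x y : Fin (m + 1) → E) (Fin.cons x' y') ≤ dist (x, y) (x', y') := by
      intro x x' y y'
      rw [dist_pi_le_iff dist_nonneg]
      intro i
      refine Fin.cases ?_ (fun j => ?_) i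
      · simp [Prod.dist_eq]
      · simp only [Fin.cons_succ, Prod.dist_eq]
        exact (dist_le_pi_dist y y' j).trans (le_max_right _ _)
    have hconsLip : LipschitzWith 1
        (fun z : E × (Fin m → E) => (Fin.cons z.1 z.2 : Fin (m + 1) → E)) := by
      refine LipschitzWith.of_dist_le_mul fun z w => ?_
      simpa using hdist z.1 w.1 z.2 w.2
    set F : E × (Fin m → E) → ℝ := fun z => f (Fin.cons z.1 z.2) with hF
    have hFl : LipschitzWith K F := by
      have h := hf.comp hconsLip
      rwa [mul_one] at h
    have hF1 : ∀ y, LipschitzWith K (fun x => F (x, y)) := by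
      intro y
      have := hFl.comp (LipschitzWith.prodMk_right (α := E) y)
      rwa [mul_one] at this
    have hF2 : ∀ x, LipschitzWith K (fun y => F (x, y)) := by
      intro x
      have := hFl.comp (LipschitzWith.prodMk_left (β := Fin m → E) x)
      rwa [mul_one] at this
    have hνL : MemLp id 2 ν := mw_memLp_pi μ hμ m
    have hprodL : MemLp (id : E × (Fin m → E) → _) 2 (μ.prod ν) := by
      have a : MemLp (fun z : E × (Fin m → E) => ‖z.1‖) 2 (μ.prod ν) :=
        (hμ.comp_measurePreserving measurePreserving_fst).norm
      have b : MemLp (fun z : E × (Fin m → E) => ‖z.2‖) 2 (μ.prod ν) :=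
        (hνL.comp_measurePreserving measurePreserving_snd).norm
      refine (a.add b).mono aestronglyMeasurable_id (Filter.Eventually.of_forall fun z => ?_)
      simp only [id, Pi.add_apply, Prod.norm_def]
      rw [Real.norm_of_nonneg (by positivity)]
      exact max_le (by linarith [norm_nonneg z.2]) (by linarith [norm_nonneg z.1])
    have hFL : MemLp F 2 (μ.prod ν) := mw_lip_memLp _ hprodL hFl
    have d1 : ∀ x y i, lineDeriv ℝ (fun x => F (x, y)) x (B i) =
        lineDeriv ℝ f (Fin.cons x y) (Pi.single 0 (B i)) := by
      intro x y i
      unfold lineDeriv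
      congr 1
      funext t
      simp only [hF]
      congr 1
      funext j
      refine Fin.cases ?_ (fun j => ?_) j
      · simp
      · simp [Pi.single_apply]
    have d2 : ∀ x y j i, lineDeriv ℝ (fun y => F (x, y)) y (Pi.single j (B i)) =
        lineDeriv ℝ f (Fin.cons x y) (Pi.single j.succ (B i)) := by
      intro x y k i
      unfold lineDeriv
      congr 1
      funext t
      simp only [hF]
      congr 1
      funext j
      refine Fin.cases ?_ (fun j => ?_) j
      · simp [Pi.single_apply, (Fin.succ_ne_zero _).symm]
      · simp [Pi.single_apply]
    have v1 : variance f (Measure.pi fun _ : Fin (m + 1) => μ) = variance F (μ.prod ν) := by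
      have := mp.variance_fun_comp (f := f) hf.continuous.aemeasurable
      simp only [hc] at this
      exact this.symm
    have hint : ∀ v, Integrable (fun z : E × (Fin m → E) =>
        (lineDeriv ℝ f (Fin.cons z.1 z.2) v) ^ 2) (μ.prod ν) := by
      intro v
      have := (mw_lineDeriv_sq (Measure.pi fun _ : Fin (m + 1) => μ) hf v)
      have := mp.integrable_comp_of_integrable this
      simp only [Function.comp_def, hc] at this
      exact this
    have hA : Integrable (fun z : E × (Fin m → E) =>
        ∑ i, (lineDeriv ℝ f (Fin.cons z.1 z.2) (Pi.single 0 (B i))) ^ 2) (μ.prod ν) :=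
      integrable_finsetSum _ fun i _ => hint _
    have hBi : Integrable (fun z : E × (Fin m → E) => ∑ p : Fin m × ι,
        (lineDeriv ℝ f (Fin.cons z.1 z.2) (Pi.single p.1.succ (B p.2))) ^ 2) (μ.prod ν) :=
      integrable_finsetSum _ fun i _ => hint _
    have e1 : ∫ x, ∑ p : Fin (m + 1) × ι, (lineDeriv ℝ f x (Pi.single p.1 (B p.2))) ^ 2
        ∂(Measure.pi fun _ : Fin (m + 1) => μ) =
        ∫ z : E × (Fin m → E), ((∑ i, (lineDeriv ℝ f (Fin.cons z.1 z.2) (Pi.single 0 (B i))) ^ 2) +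
          ∑ p : Fin m × ι, (lineDeriv ℝ f (Fin.cons z.1 z.2) (Pi.single p.1.succ (B p.2))) ^ 2)
          ∂(μ.prod ν) := by
      rw [← mp.integral_comp' (g := fun x => ∑ p : Fin (m + 1) × ι,
        (lineDeriv ℝ f x (Pi.single p.1 (B p.2))) ^ 2)]
      simp only [hc, Fintype.sum_prod_type, Fin.sum_univ_succ]
      rfl
    rw [v1, e1, integral_add hA hBi]
    refine (mw_var_sub μ ν F hFL).trans (add_le_add ?_ ?_)
    · rw [integral_prod_symm _ hA]
      refine integral_mono (mw_var_prod_aux μ ν F hFL).1 hA.integral_prod_right fun y => ?_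
      have := hB _ K (hF1 y)
      simpa only [d1] using this
    · rw [integral_prod _ hBi]
      have hG : MemLp (F ∘ Prod.swap) 2 (ν.prod μ) :=
        hFL.comp_measurePreserving Measure.measurePreserving_swap
      refine integral_mono (mw_var_prod_aux ν μ (F ∘ Prod.swap) hG).1 hBi.integral_prod_left
        fun x => ?_
      have := ih _ K (hF2 x)
      simpa only [d2] using this

lemma mw_pi_ac {E : Type} [MeasurableSpace E] (μ ν : Measure E) [SigmaFinite μ]
    [SigmaFinite ν] (h : μ ≪ ν) (m : ℕ) :
    (Measure.pi fun _ : Fin m => μ) ≪ (Measure.pi fun _ : Fin m => ν) := by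
  induction m with
  | zero => rw [Measure.pi_of_empty, Measure.pi_of_empty]
  | succ m ih =>
    have mp := (measurePreserving_piFinSuccAbove (fun _ : Fin (m + 1) => μ) 0).symm
    have mp' := (measurePreserving_piFinSuccAbove (fun _ : Fin (m + 1) => ν) 0).symm
    rw [← mp.map_eq, ← mp'.map_eq]
    exact (h.prod ih).map (MeasurableEquiv.measurable _)

open scoped Pointwise in
lemma mw_sphere_apply {k : ℕ} {s : Set (EuclideanSpace ℝ (Fin k))} (hs : MeasurableSet s) :
    uniformSphere k s = ((volume : Measure (EuclideanSpace ℝ (Fin k))).toSphere Set.univ)⁻¹ *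
      ((Module.finrank ℝ (EuclideanSpace ℝ (Fin k)) : ENNReal) *
        volume (Ioo (0 : ℝ) 1 • (s ∩ Metric.sphere (0 : EuclideanSpace ℝ (Fin k)) 1))) := by
  unfold uniformSphere
  rw [Measure.map_apply measurable_subtype_coe hs, Measure.smul_apply, smul_eq_mul,
    Measure.toSphere_apply' _ (measurable_subtype_coe hs), Subtype.image_preimage_coe,
    inter_comm]

lemma mw_sphere_prob {k : ℕ} (hk : 1 ≤ k) : IsProbabilityMeasure (uniformSphere k) := by
  constructor
  have : Nonempty (Fin k) := ⟨⟨0, hk⟩⟩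
  unfold uniformSphere
  rw [Measure.map_apply measurable_subtype_coe MeasurableSet.univ, Measure.smul_apply, smul_eq_mul,
    preimage_univ]
  refine ENNReal.inv_mul_cancel ?_ (measure_ne_top _ _)
  rw [Ne, Measure.measure_univ_eq_zero]
  exact Measure.toSphere_ne_zero _

lemma mw_sphere_norm {k : ℕ} : ∀ᵐ θ ∂(uniformSphere k), ‖θ‖ = 1 := by
  unfold uniformSphere
  rw [ae_map_iff measurable_subtype_coe.aemeasurable
    (measurableSet_eq_fun (by fun_prop) (by fun_prop))]
  exact Filter.Eventually.of_forall fun x => by simpa using x.2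

open scoped Pointwise in
lemma mw_sphere_map {k : ℕ} (U : EuclideanSpace ℝ (Fin k) ≃ₗᵢ[ℝ] EuclideanSpace ℝ (Fin k)) :
    MeasurePreserving U (uniformSphere k) (uniformSphere k) := by
  refine ⟨U.continuous.measurable, ?_⟩
  ext s hs
  have hs' : MeasurableSet (U ⁻¹' s) := U.continuous.measurable hs
  rw [Measure.map_apply U.continuous.measurable hs, mw_sphere_apply hs, mw_sphere_apply hs']
  congr 2
  have h1 : Ioo (0 : ℝ) 1 • (U ⁻¹' s ∩ Metric.sphere (0 : EuclideanSpace ℝ (Fin k)) 1) =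
      U ⁻¹' (Ioo (0 : ℝ) 1 • (s ∩ Metric.sphere (0 : EuclideanSpace ℝ (Fin k)) 1)) := by
    ext x
    simp only [Set.mem_smul, mem_preimage, mem_inter_iff, mem_sphere_zero_iff_norm]
    constructor
    · rintro ⟨r, hr, y, ⟨hy, hy1⟩, rfl⟩
      exact ⟨r, hr, U y, ⟨hy, by simpa using hy1⟩, by simp⟩
    · rintro ⟨r, hr, y, ⟨hy, hy1⟩, h⟩
      refine ⟨r, hr, U.symm y, ⟨by simpa using hy, by simpa using hy1⟩, ?_⟩
      apply U.injective
      simpa using h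
  rw [h1]
  have := U.measurePreserving.measure_preimage_emb U.toHomeomorph.measurableEmbedding
  exact this _

lemma mw_sphere_integrable {k : ℕ} (hk : 1 ≤ k) (v : EuclideanSpace ℝ (Fin k)) :
    Integrable (fun θ => ⟪v, θ⟫ ^ 2) (uniformSphere k) := by
  have := mw_sphere_prob hk
  refine Integrable.of_bound (by fun_prop) (‖v‖ ^ 2) ?_
  filter_upwards [mw_sphere_norm] with θ hθ
  rw [norm_pow]
  gcongr
  simpa [hθ] using norm_inner_le_norm (𝕜 := ℝ) v θ

lemma mw_sphere_moment {k : ℕ} (hk : 1 ≤ k) (v : EuclideanSpace ℝ (Fin k)) :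
    ∫ θ, ⟪v, θ⟫ ^ 2 ∂(uniformSphere k) = ‖v‖ ^ 2 / k := by
  have := mw_sphere_prob hk
  have inv : ∀ v w : EuclideanSpace ℝ (Fin k), ‖v‖ = ‖w‖ →
      ∫ θ, ⟪v, θ⟫ ^ 2 ∂(uniformSphere k) = ∫ θ, ⟪w, θ⟫ ^ 2 ∂(uniformSphere k) := by
    intro v w h
    set U := (ℝ ∙ (v - w))ᗮ.reflection with hU
    have h1 : U v = w := Submodule.reflection_sub h
    have := (mw_sphere_map U).integral_comp U.toHomeomorph.measurableEmbedding
      (fun θ => ⟪w, θ⟫ ^ 2)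
    rw [← this]
    simp only [← h1, LinearIsometryEquiv.inner_map_map]
  have hi : ∀ i : Fin k, ∫ θ, ⟪v, θ⟫ ^ 2 ∂(uniformSphere k) =
      ‖v‖ ^ 2 * ∫ θ, θ i ^ 2 ∂(uniformSphere k) := by
    intro i
    rw [inv v (‖v‖ • EuclideanSpace.single i (1 : ℝ)) (by simp [norm_smul]), ← integral_const_mul]
    congr 1; funext θ
    rw [real_inner_smul_left, EuclideanSpace.inner_single_left]
    simp [mul_pow]
  have hint : ∀ i : Fin k, Integrable (fun θ : EuclideanSpace ℝ (Fin k) => θ i ^ 2)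
      (uniformSphere k) := by
    intro i
    have := mw_sphere_integrable hk (EuclideanSpace.single i (1 : ℝ))
    simpa [EuclideanSpace.inner_single_left] using this
  have hs : ∑ i : Fin k, ∫ θ, θ i ^ 2 ∂(uniformSphere k) = 1 := by
    rw [← integral_finsetSum _ fun i _ => hint i]
    have : (fun θ : EuclideanSpace ℝ (Fin k) => ∑ i, θ i ^ 2) =ᵐ[uniformSphere k] fun _ => 1 := by
      filter_upwards [mw_sphere_norm] with θ hθ
      rw [← EuclideanSpace.real_norm_sq_eq, hθ]; norm_num
    rw [integral_congr_ae this]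
    simp
  have hsum := Finset.sum_congr (rfl : (Finset.univ : Finset (Fin k)) = Finset.univ)
    (fun i _ => hi i)
  rw [← Finset.mul_sum, hs] at hsum
  simp at hsum
  have : (k : ℝ) ≠ 0 := by positivity
  field_simp
  linarith

/-- The transpose action `Gᵀ θ`. -/
noncomputable def mwT {k n : ℕ} (G : Fin k → Fin n → ℝ) (θ : EuclideanSpace ℝ (Fin k)) :
    EuclideanSpace ℝ (Fin n) := WithLp.toLp 2 (fun j => ∑ i, G i j * θ i)

lemma mwT_apply {k n : ℕ} (G : Fin k → Fin n → ℝ) (θ : EuclideanSpace ℝ (Fin k)) (j : Fin n) :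
    mwT G θ j = ∑ i, G i j * θ i := rfl

lemma mwT_sub {k n : ℕ} (G H : Fin k → Fin n → ℝ) (θ : EuclideanSpace ℝ (Fin k)) :
    mwT G θ - mwT H θ = mwT (G - H) θ := by
  ext j
  simp [mwT_apply, sub_mul, Finset.sum_sub_distrib]

lemma mwT_continuous {k n : ℕ} :
    Continuous (fun p : (Fin k → Fin n → ℝ) × EuclideanSpace ℝ (Fin k) => mwT p.1 p.2) := by
  unfold mwT
  fun_prop

lemma mw_supp_image {k n : ℕ} (A : Set (EuclideanSpace ℝ (Fin n)))
    (T : Matrix (Fin k) (Fin n) ℝ) (θ : EuclideanSpace ℝ (Fin k)) :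
    suppFn (⇑(Matrix.toEuclideanLin T) '' A) θ = suppFn A (mwT T θ) := by
  unfold suppFn
  rw [image_image]
  congr 1
  apply image_congr
  intro a _
  simp only [PiLp.inner_apply, Matrix.toLpLin_apply, Matrix.mulVec, dotProduct,
    RCLike.inner_apply, conj_trivial, Finset.mul_sum]
  rw [Finset.sum_comm]
  refine Finset.sum_congr rfl fun j _ => ?_
  change _ = (∑ i, T i j * θ i) * a j
  rw [Finset.sum_mul]
  exact Finset.sum_congr rfl fun i _ => by ring

section supp
variable {n : ℕ} {A : Set (EuclideanSpace ℝ (Fin n))}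

lemma mw_norm_le (hAc : IsCompact A) {a : EuclideanSpace ℝ (Fin n)} (ha : a ∈ A) :
    ‖a‖ ≤ circumradius A :=
  le_csSup (hAc.image continuous_norm).bddAbove (mem_image_of_mem _ ha)

lemma mw_R_nonneg (hAc : IsCompact A) (hne : A.Nonempty) : 0 ≤ circumradius A := by
  obtain ⟨a, ha⟩ := hne
  exact (norm_nonneg a).trans (mw_norm_le hAc ha)

lemma mw_supp_bdd (hAc : IsCompact A) (x : EuclideanSpace ℝ (Fin n)) :
    BddAbove ((fun a => ⟪a, x⟫) '' A) :=
  (hAc.image (by fun_prop)).bddAbove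

lemma mw_supp_le (hAc : IsCompact A) (hne : A.Nonempty) (x y : EuclideanSpace ℝ (Fin n)) :
    suppFn A x - suppFn A y ≤ circumradius A * ‖x - y‖ := by
  rw [sub_le_iff_le_add']
  apply csSup_le (hne.image _)
  rintro _ ⟨a, ha, rfl⟩
  have h1 : ⟪a, y⟫ ≤ suppFn A y := le_csSup (mw_supp_bdd hAc y) (mem_image_of_mem _ ha)
  have h2 : ⟪a, x - y⟫ ≤ ‖a‖ * ‖x - y‖ := real_inner_le_norm _ _
  have h3 : ‖a‖ * ‖x - y‖ ≤ circumradius A * ‖x - y‖ :=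
    mul_le_mul_of_nonneg_right (mw_norm_le hAc ha) (norm_nonneg _)
  rw [inner_sub_right] at h2
  simp only
  linarith

lemma mw_supp_abs (hAc : IsCompact A) (hne : A.Nonempty) (x y : EuclideanSpace ℝ (Fin n)) :
    |suppFn A x - suppFn A y| ≤ circumradius A * ‖x - y‖ := by
  rw [abs_le]
  have h1 := mw_supp_le hAc hne x y
  have h2 := mw_supp_le hAc hne y x
  rw [norm_sub_rev] at h2
  constructor <;> linarith

lemma mw_supp_lip (hAc : IsCompact A) (hne : A.Nonempty) :
    LipschitzWith (circumradius A).toNNReal (suppFn A) := by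
  apply LipschitzWith.of_dist_le_mul
  intro x y
  rw [Real.dist_eq, dist_eq_norm, Real.coe_toNNReal _ (mw_R_nonneg hAc hne)]
  exact mw_supp_abs hAc hne x y

lemma mw_supp_zero (hne : A.Nonempty) : suppFn A 0 = 0 := by
  unfold suppFn
  simp [hne.image_const]

end supp

lemma mw_hs_nonneg {k n : ℕ} (T : Matrix (Fin k) (Fin n) ℝ) : 0 ≤ hsNorm T :=
  Real.sqrt_nonneg _

lemma mw_hs_sq {k n : ℕ} (T : Matrix (Fin k) (Fin n) ℝ) :
    hsNorm T ^ 2 = ∑ i, ∑ j, T i j ^ 2 :=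
  Real.sq_sqrt (Finset.sum_nonneg fun _ _ => Finset.sum_nonneg fun _ _ => sq_nonneg _)

lemma mwT_norm_sq {k n : ℕ} (G : Fin k → Fin n → ℝ) (θ : EuclideanSpace ℝ (Fin k)) :
    ‖mwT G θ‖ ^ 2 = ∑ j, ⟪(WithLp.toLp 2 (fun i => G i j) : EuclideanSpace ℝ (Fin k)), θ⟫ ^ 2 := by
  rw [EuclideanSpace.norm_sq_eq]
  refine Finset.sum_congr rfl fun j _ => ?_
  rw [Real.norm_eq_abs, sq_abs, mwT_apply, PiLp.inner_apply]
  simp [mul_comm]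

lemma mwT_norm_le {k n : ℕ} (G : Fin k → Fin n → ℝ) (θ : EuclideanSpace ℝ (Fin k)) :
    ‖mwT G θ‖ ≤ hsNorm (Matrix.of G) * ‖θ‖ := by
  refine (pow_le_pow_iff_left₀ (norm_nonneg _)
    (mul_nonneg (mw_hs_nonneg _) (norm_nonneg _)) two_ne_zero).1 ?_
  rw [mul_pow, mw_hs_sq, mwT_norm_sq, Finset.sum_comm, Finset.sum_mul]
  refine Finset.sum_le_sum fun j _ => ?_
  have := abs_real_inner_le_norm (WithLp.toLp 2 (fun i => G i j) : EuclideanSpace ℝ (Fin k)) θ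
  have h2 := pow_le_pow_left₀ (abs_nonneg _) this 2
  rw [sq_abs, mul_pow, EuclideanSpace.norm_sq_eq] at h2
  simpa using h2

lemma mw_sphere_hs {k n : ℕ} (hk : 1 ≤ k) (G : Fin k → Fin n → ℝ) :
    ∫ θ, ‖mwT G θ‖ ^ 2 ∂uniformSphere k = hsNorm (Matrix.of G) ^ 2 / k := by
  have := mw_sphere_prob hk
  simp_rw [mwT_norm_sq]
  rw [integral_finsetSum]
  · simp_rw [mw_sphere_moment hk]
    rw [← Finset.sum_div, mw_hs_sq, Finset.sum_comm]
    simp [EuclideanSpace.norm_sq_eq]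
  · intro j _
    exact mw_sphere_integrable hk _

lemma mw_charFun_pi_real {m : ℕ} (s : Fin m → ℝ) :
    ∫ x : Fin m → ℝ, Complex.exp ((∑ j, s j * x j : ℝ) * Complex.I)
      ∂(Measure.pi fun _ : Fin m => gaussianReal 0 1)
      = Complex.exp (-((∑ j, s j ^ 2 : ℝ) : ℂ) / 2) := by
  have h : ∀ x : Fin m → ℝ, Complex.exp ((∑ j, s j * x j : ℝ) * Complex.I)
      = ∏ j, Complex.exp (s j * x j * Complex.I) := by
    intro x
    rw [← Complex.exp_sum, ← Finset.sum_mul]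
    push_cast
    rfl
  simp_rw [h]
  rw [integral_fintype_prod_eq_prod (𝕜 := ℂ)
    (fun (j : Fin m) (y : ℝ) => Complex.exp (s j * y * Complex.I))]
  simp_rw [← charFun_apply_real, charFun_gaussianReal]
  rw [← Complex.exp_sum]
  congr 1
  push_cast
  rw [← Finset.sum_neg_distrib, Finset.sum_div]
  refine Finset.sum_congr rfl fun j _ => ?_
  simp
  try ring

lemma mw_law {k n : ℕ} (θ : EuclideanSpace ℝ (Fin k)) (hθ : ‖θ‖ = 1) :
    (stdGaussianMatrix k n).map (fun G => mwT G θ) = _root_.stdGaussian n := by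
  have hm : Measurable (fun G : Fin k → Fin n → ℝ => mwT G θ) :=
    (mwT_continuous.comp (by fun_prop : Continuous fun G : Fin k → Fin n → ℝ => (G, θ))).measurable
  have p1 : IsProbabilityMeasure (stdGaussianMatrix k n) := by
    unfold stdGaussianMatrix; infer_instance
  have p2 : IsProbabilityMeasure (_root_.stdGaussian n) := by
    unfold _root_.stdGaussian
    exact Measure.isProbabilityMeasure_map (by fun_prop)
  have p3 : IsProbabilityMeasure ((stdGaussianMatrix k n).map (fun G => mwT G θ)) :=
    Measure.isProbabilityMeasure_map hm.aemeasurable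
  apply Measure.ext_of_charFun
  ext t
  rw [charFun_apply, charFun_apply, integral_map hm.aemeasurable
    (Continuous.aestronglyMeasurable (by fun_prop))]
  unfold _root_.stdGaussian
  rw [integral_map (by fun_prop) (Continuous.aestronglyMeasurable (by fun_prop))]
  have hR : ∀ x : Fin n → ℝ, Complex.exp ((⟪(EuclideanSpace.equiv (Fin n) ℝ).symm x, t⟫ : ℝ)
      * Complex.I) = Complex.exp ((∑ j, t j * x j : ℝ) * Complex.I) := by
    intro x
    congr 3
  have hL : ∀ G : Fin k → Fin n → ℝ, Complex.exp ((⟪mwT G θ, t⟫ : ℝ) * Complex.I)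
      = ∏ i, Complex.exp ((∑ j, (θ i * t j) * G i j : ℝ) * Complex.I) := by
    intro G
    rw [← Complex.exp_sum, ← Finset.sum_mul, ← Complex.ofReal_sum]
    congr 3
    rw [PiLp.inner_apply, Finset.sum_comm]
    refine Finset.sum_congr rfl fun j _ => ?_
    change t j * (∑ i, G i j * θ i) = _
    rw [Finset.mul_sum]
    exact Finset.sum_congr rfl fun i _ => by ring
  refine Eq.trans (integral_congr_ae (.of_forall hL)) ?_
  refine Eq.trans ?_ (integral_congr_ae (.of_forall hR)).symm
  unfold stdGaussianMatrix
  rw [integral_fintype_prod_eq_prod (𝕜 := ℂ) (fun (i : Fin k) (x : Fin n → ℝ) =>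
    Complex.exp ((∑ j, (θ i * t j) * x j : ℝ) * Complex.I))]
  simp_rw [mw_charFun_pi_real]
  rw [← Complex.exp_sum, ← Finset.sum_div, Finset.sum_neg_distrib, ← Complex.ofReal_sum]
  congr 4
  simp_rw [mul_pow, ← Finset.mul_sum]
  rw [← Finset.sum_mul]
  have : ∑ i, θ i ^ 2 = 1 := by
    have := EuclideanSpace.norm_sq_eq θ
    simpa [hθ] using this.symm
  rw [this, one_mul]

lemma mw_jensen {α : Type*} [MeasurableSpace α] {μ : Measure α} [IsProbabilityMeasure μ]
    {f : α → ℝ} (hf : MemLp f 2 μ) : (∫ x, f x ∂μ) ^ 2 ≤ ∫ x, f x ^ 2 ∂μ := by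
  have h := variance_nonneg f μ
  rw [variance_eq_sub hf] at h
  simpa using h

section main
variable {n k : ℕ} {A : Set (EuclideanSpace ℝ (Fin n))}

lemma mw_mean_eq (T : Matrix (Fin k) (Fin n) ℝ) :
    meanWidth (⇑(Matrix.toEuclideanLin T) '' A) = ∫ θ, suppFn A (mwT T θ) ∂uniformSphere k := by
  unfold meanWidth
  simp_rw [mw_supp_image]

lemma mw_F_cont (hAc : IsCompact A) (hne : A.Nonempty) :
    Continuous (fun p : (Fin k → Fin n → ℝ) × EuclideanSpace ℝ (Fin k) =>
      suppFn A (mwT p.1 p.2)) :=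
  (mw_supp_lip hAc hne).continuous.comp mwT_continuous

lemma mw_F_bound (hAc : IsCompact A) (hne : A.Nonempty) (G : Fin k → Fin n → ℝ)
    (θ : EuclideanSpace ℝ (Fin k)) (hθ : ‖θ‖ = 1) :
    |suppFn A (mwT G θ)| ≤ circumradius A * hsNorm (Matrix.of G) := by
  have h := mw_supp_abs hAc hne (mwT G θ) 0
  rw [mw_supp_zero hne, sub_zero, sub_zero] at h
  have h2 := mwT_norm_le G θ
  rw [hθ, mul_one] at h2
  exact h.trans (mul_le_mul_of_nonneg_left h2 (mw_R_nonneg hAc hne))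

lemma mw_F_int (hk : 1 ≤ k) (hAc : IsCompact A) (hne : A.Nonempty) (G : Fin k → Fin n → ℝ) :
    Integrable (fun θ => suppFn A (mwT G θ)) (uniformSphere k) := by
  have := mw_sphere_prob hk
  have hc := (mw_F_cont (k := k) hAc hne).comp (Continuous.prodMk_right G)
  refine Integrable.of_bound hc.aestronglyMeasurable
    (circumradius A * hsNorm (Matrix.of G)) ?_
  filter_upwards [mw_sphere_norm] with θ hθ
  exact mw_F_bound hAc hne G θ hθ

lemma mw_part_one (hk : 1 ≤ k) (hAc : IsCompact A) (hne : A.Nonempty)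
    (T S : Matrix (Fin k) (Fin n) ℝ) :
    |meanWidth (⇑(Matrix.toEuclideanLin T) '' A) -
          meanWidth (⇑(Matrix.toEuclideanLin S) '' A)| ≤
        (circumradius A / Real.sqrt k) * hsNorm (T - S) := by
  have := mw_sphere_prob hk
  have hR := mw_R_nonneg hAc hne
  rw [mw_mean_eq, mw_mean_eq, ← integral_sub (mw_F_int hk hAc hne T) (mw_F_int hk hAc hne S)]
  set M : Fin k → Fin n → ℝ := fun i j => T i j - S i j with hM
  have hMc : Continuous fun θ : EuclideanSpace ℝ (Fin k) => ‖mwT M θ‖ :=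
    (mwT_continuous.comp (Continuous.prodMk_right M)).norm
  have hLp : MemLp (fun θ => ‖mwT M θ‖) 2 (uniformSphere k) := by
    refine MemLp.of_bound hMc.aestronglyMeasurable (hsNorm (Matrix.of M)) ?_
    filter_upwards [mw_sphere_norm] with θ hθ
    simpa [hθ] using mwT_norm_le M θ
  have hj := mw_jensen hLp
  rw [mw_sphere_hs hk] at hj
  have hj2 : ∫ θ, ‖mwT M θ‖ ∂uniformSphere k ≤ hsNorm (Matrix.of M) / √k := by
    have h := Real.sqrt_le_sqrt hj
    rwa [Real.sqrt_sq (integral_nonneg fun _ => norm_nonneg _), Real.sqrt_div (sq_nonneg _),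
      Real.sqrt_sq (mw_hs_nonneg _)] at h
  calc _ ≤ ∫ θ, ‖suppFn A (mwT T θ) - suppFn A (mwT S θ)‖ ∂uniformSphere k :=
        norm_integral_le_integral_norm _
    _ ≤ ∫ θ, circumradius A * ‖mwT M θ‖ ∂uniformSphere k := by
        refine integral_mono_of_nonneg (.of_forall fun _ => norm_nonneg _)
          ((hLp.integrable (by norm_num)).const_mul _) (.of_forall fun θ => ?_)
        have := mw_supp_abs hAc hne (mwT T θ) (mwT S θ)
        have e : mwT T θ - mwT S θ = mwT M θ := mwT_sub T S θ
        rw [e] at this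
        exact this
    _ = circumradius A * ∫ θ, ‖mwT M θ‖ ∂uniformSphere k := integral_const_mul _ _
    _ ≤ circumradius A * (hsNorm (Matrix.of M) / √k) := mul_le_mul_of_nonneg_left hj2 hR
    _ = _ := by
        have : Matrix.of M = T - S := rfl
        rw [this]; ring

end main

lemma mw_hs_le {k n : ℕ} (G : Fin k → Fin n → ℝ) :
    hsNorm (Matrix.of G) ≤ √(k * n) * ‖G‖ := by
  refine (pow_le_pow_iff_left₀ (mw_hs_nonneg _)
    (mul_nonneg (Real.sqrt_nonneg _) (norm_nonneg _)) two_ne_zero).1 ?_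
  rw [mw_hs_sq, mul_pow, Real.sq_sqrt (by positivity)]
  calc ∑ i, ∑ j, (Matrix.of G) i j ^ 2 ≤ ∑ _i : Fin k, ∑ _j : Fin n, ‖G‖ ^ 2 := by
        refine Finset.sum_le_sum fun i _ => Finset.sum_le_sum fun j _ => ?_
        rw [Matrix.of_apply, ← sq_abs]
        exact pow_le_pow_left₀ (abs_nonneg _)
          ((norm_le_pi_norm (G i) j).trans (norm_le_pi_norm G i)) 2
    _ = _ := by simp; ring

lemma mw_matrix_poinc (k n : ℕ) :
    mwPoinc (stdGaussianMatrix k n)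
      (fun p : Fin k × (Fin n × Unit) => Pi.single p.1 (Pi.single p.2.1 (1 : ℝ))) := by
  unfold stdGaussianMatrix
  have h1 := mwPoinc_pi (gaussianReal 0 1) (memLp_id_gaussianReal 2) _ mwPoinc_real n
  exact mwPoinc_pi _ (mw_memLp_pi _ (memLp_id_gaussianReal 2) n) _ h1 k

lemma mw_matrix_ac (k n : ℕ) : stdGaussianMatrix k n ≪ volume := by
  unfold stdGaussianMatrix
  exact mw_pi_ac _ _ (mw_pi_ac _ _ (gaussianReal_absolutelyContinuous 0 one_ne_zero) n) k

lemma mw_fderiv_sum {k n : ℕ} (D : (Fin k → Fin n → ℝ) →L[ℝ] ℝ) {L : ℝ}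
    (hD : ∀ v, |D v| ≤ L * hsNorm (Matrix.of v)) :
    ∑ p : Fin k × (Fin n × Unit), (D (Pi.single p.1 (Pi.single p.2.1 (1 : ℝ)))) ^ 2 ≤ L ^ 2 := by
  set v : Fin k → Fin n → ℝ := fun i j => D (Pi.single i (Pi.single j (1 : ℝ))) with hv
  have hs : ∑ p : Fin k × (Fin n × Unit), (D (Pi.single p.1 (Pi.single p.2.1 (1 : ℝ)))) ^ 2
      = hsNorm (Matrix.of v) ^ 2 := by
    rw [mw_hs_sq, Fintype.sum_prod_type]
    refine Finset.sum_congr rfl fun i _ => ?_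
    rw [Fintype.sum_prod_type]
    simp [hv]
  have hvv : v = ∑ i, ∑ j, v i j • (Pi.single i (Pi.single j (1 : ℝ)) : Fin k → Fin n → ℝ) := by
    ext a b
    simp only [Finset.sum_apply, Pi.smul_apply, smul_eq_mul]
    rw [Finset.sum_eq_single a, Finset.sum_eq_single b]
    · simp
    · intro j _ hj; simp [hj.symm]
    · simp
    · intro i _ hi
      refine Finset.sum_eq_zero fun j _ => ?_
      simp [Pi.single_eq_of_ne hi.symm]
    · simp
  have hDv : D v = hsNorm (Matrix.of v) ^ 2 := by
    conv_lhs => rw [hvv]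
    rw [mw_hs_sq]
    simp only [map_sum, map_smul, smul_eq_mul]
    refine Finset.sum_congr rfl fun i _ => Finset.sum_congr rfl fun j _ => ?_
    simp [hv, sq]
  rw [hs]
  have h := hD v
  rw [hDv, abs_of_nonneg (sq_nonneg _)] at h
  have h0 := mw_hs_nonneg (Matrix.of v)
  rcases h0.eq_or_lt with h1 | h1
  · rw [← h1]; simpa using sq_nonneg L
  · have : hsNorm (Matrix.of v) ≤ L := by
      rw [sq] at h
      exact le_of_mul_le_mul_right h h1
    exact pow_le_pow_left₀ h0 this 2

lemma mw_part_two_a {k n : ℕ} (f : (Fin k → Fin n → ℝ) → ℝ) {L : ℝ} (hL : 0 ≤ L)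
    (hf : ∀ T S, |f T - f S| ≤ L * hsNorm (Matrix.of (T - S))) :
    variance f (stdGaussianMatrix k n) ≤ L ^ 2 := by
  have p1 : IsProbabilityMeasure (stdGaussianMatrix k n) := by
    unfold stdGaussianMatrix; infer_instance
  have hlip : LipschitzWith (L * √(k * n)).toNNReal f := by
    apply LipschitzWith.of_dist_le_mul
    intro x y
    rw [Real.dist_eq, dist_eq_norm, Real.coe_toNNReal _ (by positivity), mul_assoc]
    exact (hf x y).trans (mul_le_mul_of_nonneg_left (mw_hs_le _) hL)
  refine (mw_matrix_poinc k n f _ hlip).trans ?_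
  have hae : ∀ᵐ G ∂(stdGaussianMatrix k n),
      ∑ p : Fin k × (Fin n × Unit),
        (lineDeriv ℝ f G (Pi.single p.1 (Pi.single p.2.1 (1 : ℝ)))) ^ 2 ≤ L ^ 2 := by
    filter_upwards [(mw_matrix_ac k n).ae_le (hlip.ae_differentiableAt (μ := volume))] with G hG
    simp_rw [hG.lineDeriv_eq_fderiv]
    apply mw_fderiv_sum
    intro v
    have ht := (hG.hasFDerivAt.hasLineDerivAt v)
    have ht2 : HasDerivAt (fun t : ℝ => f (G + t • v)) (fderiv ℝ f G v) 0 := ht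
    have := ht2.tendsto_slope
    refine le_of_tendsto this.abs ?_
    filter_upwards [self_mem_nhdsWithin] with t ht0
    have ht0 : t ≠ 0 := ht0
    rw [slope_def_field, abs_div, sub_zero, div_le_iff₀ (abs_pos.2 ht0)]
    refine (hf _ _).trans (le_of_eq ?_)
    have e : (G + t • v) - (G + (0 : ℝ) • v) = t • v := by simp
    rw [e]
    have : hsNorm (Matrix.of (t • v)) = |t| * hsNorm (Matrix.of v) := by
      unfold hsNorm
      rw [← Real.sqrt_sq_eq_abs, ← Real.sqrt_mul (sq_nonneg t)]
      congr 1
      simp [Finset.mul_sum, mul_pow]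
    rw [this]; ring
  calc _ ≤ ∫ _ : Fin k → Fin n → ℝ, L ^ 2 ∂(stdGaussianMatrix k n) :=
        integral_mono_of_nonneg
          (.of_forall fun _ => Finset.sum_nonneg fun _ _ => sq_nonneg _)
          (integrable_const _) hae
    _ = L ^ 2 := by simp

lemma mw_part_two_b {n k : ℕ} {A : Set (EuclideanSpace ℝ (Fin n))} (hk : 1 ≤ k)
    (hAc : IsCompact A) (hne : A.Nonempty) :
    variance (fun G => ∫ θ, suppFn A (mwT G θ) ∂uniformSphere k) (stdGaussianMatrix k n)
      ≤ variance (suppFn A) (_root_.stdGaussian n) := by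
  have p1 : IsProbabilityMeasure (stdGaussianMatrix k n) := by
    unfold stdGaussianMatrix; infer_instance
  have p2 := mw_sphere_prob hk
  have hFc := mw_F_cont (k := k) hAc hne
  have hid : MemLp (fun G : Fin k → Fin n → ℝ => G) 2 (stdGaussianMatrix k n) :=
    mw_memLp_pi _ (mw_memLp_pi _ (memLp_id_gaussianReal 2) n) k
  have hF : MemLp (fun p : (Fin k → Fin n → ℝ) × EuclideanSpace ℝ (Fin k) =>
      suppFn A (mwT p.1 p.2)) 2 ((stdGaussianMatrix k n).prod (uniformSphere k)) := by
    have hg : MemLp (fun p : (Fin k → Fin n → ℝ) × EuclideanSpace ℝ (Fin k) => p.1) 2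
        ((stdGaussianMatrix k n).prod (uniformSphere k)) := hid.comp_fst _
    refine hg.of_le_mul (c := circumradius A * √(k * n)) hFc.aestronglyMeasurable ?_
    have hs : ∀ᵐ p ∂((stdGaussianMatrix k n).prod (uniformSphere k)), ‖p.2‖ = 1 :=
      Measure.quasiMeasurePreserving_snd.ae mw_sphere_norm
    filter_upwards [hs] with p hp
    refine (mw_F_bound hAc hne p.1 p.2 hp).trans ?_
    rw [mul_assoc]
    exact mul_le_mul_of_nonneg_left (mw_hs_le _) (mw_R_nonneg hAc hne)
  refine (mw_var_avg _ _ _ hF).trans (le_of_eq ?_)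
  have hae : ∀ᵐ θ ∂(uniformSphere k),
      variance (fun G => suppFn A (mwT G θ)) (stdGaussianMatrix k n)
        = variance (suppFn A) (_root_.stdGaussian n) := by
    filter_upwards [mw_sphere_norm] with θ hθ
    have hm : Measurable (fun G : Fin k → Fin n → ℝ => mwT G θ) :=
      (mwT_continuous.comp
        (by fun_prop : Continuous fun G : Fin k → Fin n → ℝ => (G, θ))).measurable
    rw [← mw_law θ hθ, variance_map
      (mw_supp_lip hAc hne).continuous.aestronglyMeasurable.aemeasurable hm.aemeasurable]
    rfl
  rw [integral_congr_ae hae]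
  simp

/-- For a symmetric convex body `A ⊆ ℝⁿ` and `1 ≤ k ≤ n`:
(1) `T ↦ w(TA)` is Lipschitz: `|w(TA) − w(SA)| ≤ (R(A)/√k) ‖T−S‖_HS`; and
(2) for a `k×n` Gaussian random matrix `G`,
`Var[w(GA)] ≤ min{R(A)²/k, Var[h_A(Z)]}` with `Z ~ γ_n`. -/
theorem mean_width_lipschitz_and_variance
    (n k : ℕ) (hk : 1 ≤ k) (hkn : k ≤ n)
    (A : Set (EuclideanSpace ℝ (Fin n)))
    (hAc : IsCompact A) (hAconv : Convex ℝ A) (hAsymm : A = -A)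
    (hAint : (interior A).Nonempty) :
    (∀ T S : Matrix (Fin k) (Fin n) ℝ,
      |meanWidth (⇑(Matrix.toEuclideanLin T) '' A) -
          meanWidth (⇑(Matrix.toEuclideanLin S) '' A)| ≤
        (circumradius A / Real.sqrt k) * hsNorm (T - S)) ∧
    variance (fun G => meanWidth (⇑(Matrix.toEuclideanLin (Matrix.of G)) '' A))
        (stdGaussianMatrix k n) ≤
      min (circumradius A ^ 2 / k) (variance (suppFn A) (stdGaussian n)) := by
  have hne : A.Nonempty := hAint.mono interior_subset
  refine ⟨fun T S => mw_part_one hk hAc hne T S, le_min ?_ ?_⟩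
  · have h := mw_part_two_a
      (fun G : Fin k → Fin n → ℝ => meanWidth (⇑(Matrix.toEuclideanLin (Matrix.of G)) '' A))
      (L := circumradius A / Real.sqrt k)
      (div_nonneg (mw_R_nonneg hAc hne) (Real.sqrt_nonneg _))
      (fun T S => mw_part_one hk hAc hne (Matrix.of T) (Matrix.of S))
    rwa [div_pow, Real.sq_sqrt (Nat.cast_nonneg k)] at h
  · have h := mw_part_two_b (k := k) hk hAc hne
    have e : (fun G : Fin k → Fin n → ℝ =>
        meanWidth (⇑(Matrix.toEuclideanLin (Matrix.of G)) '' A))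
        = fun G => ∫ θ, suppFn A (mwT G θ) ∂uniformSphere k := by
      funext G
      exact mw_mean_eq (Matrix.of G)
    rw [e]
    exact h
end

section
/- Let A be a symmetric convex body in ℝⁿ, let 1 ≤ k ≤ n, and let T be a k×n real matrix of rank k with singular values s₁(T) ≥ … ≥ s_k(T) > 0. Let F = Im(T*) ⊆ ℝⁿ be the row space of T, and let w(P_F A) = ∫_{S_F} h_A(φ) dσ_F(φ) denote the mean width of the orthogonal projection P_F A computed inside F. Then s_k(T)·w(P_F A) ≤ w(TA) ≤ s₁(T)·w(P_F A), where w(TA) = ∫_{S^{k−1}} h_{TA}(θ) dσ_k(θ). -/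
open MeasureTheory ProbabilityTheory Real Set
open scoped Matrix RealInnerProductSpace

/-- The average of `f` over the unit sphere `S_F` of a subspace `F ⊆ ℝⁿ` with respect to
the rotation-invariant probability measure `σ_F`, computed by transporting the uniform
sphere measure of `ℝ^{dim F}` through a linear isometry coming from an orthonormal basis
of `F` (independent of the choice by rotation invariance). Applied to `f = h_A` this is
the mean width `w(P_F A)` of the orthogonal projection of `A` onto `F`, computed inside
`F` (recall `h_{P_F A} = h_A` on `F`). -/
noncomputable def subsphereAvg {n : ℕ} (F : Submodule ℝ (EuclideanSpace ℝ (Fin n)))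
    (f : EuclideanSpace ℝ (Fin n) → ℝ) : ℝ :=
  ∫ θ, f (((stdOrthonormalBasis ℝ F).repr.symm θ : F) : EuclideanSpace ℝ (Fin n))
    ∂uniformSphere (Module.finrank ℝ F)

/-- The largest singular value `s₁(T) = max_{‖x‖₂ = 1} ‖Tx‖₂` of a `k × n` matrix. -/
noncomputable def maxSingularValue {k n : ℕ} (T : Matrix (Fin k) (Fin n) ℝ) : ℝ :=
  sSup {r : ℝ | ∃ x : EuclideanSpace ℝ (Fin n), ‖x‖ = 1 ∧ r = ‖Matrix.toEuclideanLin T x‖}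

/-- The smallest singular value `s_k(T) = min_{‖y‖₂ = 1} ‖T*y‖₂` of a `k × n` matrix of
rank `k`. -/
noncomputable def minSingularValue {k n : ℕ} (T : Matrix (Fin k) (Fin n) ℝ) : ℝ :=
  sInf {r : ℝ | ∃ y : EuclideanSpace ℝ (Fin k), ‖y‖ = 1 ∧ r = ‖Matrix.toEuclideanLin Tᵀ y‖}

open scoped Pointwise in
theorem uS_map {k : ℕ} (L : EuclideanSpace ℝ (Fin k) ≃ₗᵢ[ℝ] EuclideanSpace ℝ (Fin k)) :
    (uniformSphere k).map L = uniformSphere k := by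
  have hL : Measurable L := L.continuous.measurable
  ext s hs
  rw [Measure.map_apply hL hs]
  unfold uniformSphere
  rw [Measure.map_apply measurable_subtype_coe (hL hs),
    Measure.map_apply measurable_subtype_coe hs, Measure.smul_apply, Measure.smul_apply,
    Measure.toSphere_apply' _ (measurable_subtype_coe (hL hs)),
    Measure.toSphere_apply' _ (measurable_subtype_coe hs)]
  congr 2
  have hmp : MeasurePreserving L.toMeasurableEquiv volume volume := L.measurePreserving
  rw [← hmp.measure_preimage_equiv (Ioo (0 : ℝ) 1 •
    ((Subtype.val : Metric.sphere (0 : EuclideanSpace ℝ (Fin k)) 1 → _) '' (Subtype.val ⁻¹' s)))]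
  congr 1
  ext x
  simp only [Set.mem_smul, Set.mem_preimage, Set.mem_image, Subtype.exists,
    LinearIsometryEquiv.coe_toMeasurableEquiv]
  constructor
  · rintro ⟨r, hr, y, ⟨z, hz, hzs, rfl⟩, rfl⟩
    exact ⟨r, hr, L z, ⟨L z, by simpa using hz, hzs, rfl⟩, by simp⟩
  · rintro ⟨r, hr, y, ⟨z, hz, hzs, rfl⟩, h⟩
    refine ⟨r, hr, L.symm z, ⟨L.symm z, by simpa using hz, by simpa using hzs, rfl⟩, ?_⟩
    apply L.injective
    simpa using h

theorem uS_integrable {k : ℕ} {g : EuclideanSpace ℝ (Fin k) → ℝ} (hg : Continuous g) :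
    Integrable g (uniformSphere k) := by
  unfold uniformSphere
  have he : MeasurableEmbedding
      (Subtype.val : Metric.sphere (0 : EuclideanSpace ℝ (Fin k)) 1 → _) :=
    MeasurableEmbedding.subtype_coe Metric.isClosed_sphere.measurableSet
  rw [he.integrable_map_iff]
  by_cases h : (volume : Measure (EuclideanSpace ℝ (Fin k))).toSphere = 0
  · rw [h]; simp
  have hc : Continuous (g ∘ (Subtype.val : Metric.sphere (0 : EuclideanSpace ℝ (Fin k)) 1 → _)) :=
    hg.comp continuous_subtype_val
  refine Integrable.smul_measure ?_ ?_
  · have : CompactSpace (Metric.sphere (0 : EuclideanSpace ℝ (Fin k)) 1) :=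
      isCompact_iff_compactSpace.mp (isCompact_sphere _ _)
    exact hc.integrable_of_hasCompactSupport (HasCompactSupport.of_compactSpace _)
  · rw [ENNReal.inv_ne_top]
    simpa only [ne_eq, Measure.measure_univ_eq_zero] using h

theorem uS_integral_comp {k : ℕ} (g : EuclideanSpace ℝ (Fin k) → ℝ)
    (L : EuclideanSpace ℝ (Fin k) ≃ₗᵢ[ℝ] EuclideanSpace ℝ (Fin k)) :
    ∫ θ, g (L θ) ∂uniformSphere k = ∫ θ, g θ ∂uniformSphere k := by
  conv_rhs => rw [← uS_map L]
  exact (L.toMeasurableEquiv.measurableEmbedding.integral_map g).symm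

theorem scale_one {k : ℕ} {g : EuclideanSpace ℝ (Fin k) → ℝ} (hg : Continuous g)
    (hconv : ConvexOn ℝ univ g) (v : EuclideanSpace ℝ (Fin k)) (hv : ‖v‖ = 1)
    {d : ℝ} (hd0 : 0 ≤ d) (hd1 : d ≤ 1) :
    ∫ θ, g (θ - ((1 - d) * ⟪v, θ⟫) • v) ∂uniformSphere k ≤ ∫ θ, g θ ∂uniformSphere k := by
  let L := (ℝ ∙ v)ᗮ.reflection
  have hL : ∀ θ, L θ = θ - (2 * ⟪v, θ⟫) • v := by
    intro θ
    simp only [L]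
    rw [Submodule.reflection_orthogonal_apply, Submodule.reflection_singleton_apply]
    simp [hv, mul_smul, two_smul]
  have hc : Continuous fun θ => g (L θ) := hg.comp L.continuous
  calc ∫ θ, g (θ - ((1 - d) * ⟪v, θ⟫) • v) ∂uniformSphere k
      ≤ ∫ θ, ((1 + d) / 2 * g θ + (1 - d) / 2 * g (L θ)) ∂uniformSphere k := by
        apply integral_mono
        · exact uS_integrable (hg.comp (by fun_prop))
        · exact uS_integrable (by fun_prop)
        · intro θ
          have := hconv.2 (mem_univ θ) (mem_univ (L θ))
            (show 0 ≤ (1 + d) / 2 by linarith) (show 0 ≤ (1 - d) / 2 by linarith) (by ring)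
          simp only [smul_eq_mul] at this
          convert this using 2
          rw [hL]
          module
    _ = _ := by
        rw [integral_add ((uS_integrable hg).const_mul _) ((uS_integrable hc).const_mul _),
          integral_const_mul, integral_const_mul, uS_integral_comp]
        ring

theorem scale_many {k : ℕ} (e : OrthonormalBasis (Fin k) ℝ (EuclideanSpace ℝ (Fin k)))
    (d : Fin k → ℝ) (hd0 : ∀ i, 0 ≤ d i) (hd1 : ∀ i, d i ≤ 1) (s : Finset (Fin k)) :
    ∀ {g : EuclideanSpace ℝ (Fin k) → ℝ}, Continuous g → ConvexOn ℝ univ g →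
    ∫ θ, g (θ - ∑ i ∈ s, ((1 - d i) * ⟪e i, θ⟫) • e i) ∂uniformSphere k
      ≤ ∫ θ, g θ ∂uniformSphere k := by
  induction s using Finset.induction_on with
  | empty => intro g _ _; simp
  | insert j s hj ih =>
    intro g hg hconv
    let D : EuclideanSpace ℝ (Fin k) →ₗ[ℝ] EuclideanSpace ℝ (Fin k) :=
      { toFun := fun θ => θ - ((1 - d j) * ⟪e j, θ⟫) • e j
        map_add' := by intro x y; rw [inner_add_right]; module
        map_smul' := by intro c x; simp only [inner_smul_right, RingHom.id_apply]; module }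
    have hD : Continuous D := D.continuous_of_finiteDimensional
    have h1 := ih (g := g ∘ D) (hg.comp hD) (hconv.comp_linearMap D)
    have h2 := scale_one hg hconv (e j) (e.norm_eq_one j) (hd0 j) (hd1 j)
    refine le_trans (le_of_eq ?_) (h1.trans h2)
    congr 1
    ext θ
    simp only [Function.comp]
    congr 1
    rw [Finset.sum_insert hj]
    have : ⟪e j, θ - ∑ i ∈ s, ((1 - d i) * ⟪e i, θ⟫) • e i⟫ = ⟪e j, θ⟫ := by
      rw [inner_sub_right, inner_sum, Finset.sum_eq_zero, sub_zero]
      intro i hi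
      rw [inner_smul_right, e.inner_eq_zero (by rintro rfl; exact hj hi), mul_zero]
    simp only [D, LinearMap.coe_mk, AddHom.coe_mk]
    rw [this]
    abel

theorem contraction {k : ℕ} {g : EuclideanSpace ℝ (Fin k) → ℝ} (hg : Continuous g)
    (hconv : ConvexOn ℝ univ g)
    (C : EuclideanSpace ℝ (Fin k) →ₗ[ℝ] EuclideanSpace ℝ (Fin k)) (hC : ∀ x, ‖C x‖ ≤ ‖x‖) :
    ∫ θ, g (C θ) ∂uniformSphere k ≤ ∫ θ, g θ ∂uniformSphere k := by
  have hsym : (C.adjoint ∘ₗ C).IsSymmetric := C.isPositive_adjoint_comp_self.isSymmetric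
  have hn : Module.finrank ℝ (EuclideanSpace ℝ (Fin k)) = k := by simp
  let e := hsym.eigenvectorBasis hn
  have horth : Pairwise fun i j => ⟪C (e i), C (e j)⟫ = 0 := by
    intro i j hij
    rw [← LinearMap.adjoint_inner_right, ← LinearMap.comp_apply,
      hsym.apply_eigenvectorBasis hn j, inner_smul_right]
    change _ * ⟪e i, e j⟫ = 0
    rw [e.inner_eq_zero hij, mul_zero]
  let b := InnerProductSpace.gramSchmidtOrthonormalBasis (𝕜 := ℝ) (ι := Fin k)
    (by simp) (fun i => C (e i))
  have hb : ∀ i, C (e i) = ‖C (e i)‖ • b i := by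
    intro i
    by_cases h : C (e i) = 0
    · simp [h]
    · have : b i = _ :=
        InnerProductSpace.gramSchmidtOrthonormalBasis_apply_of_orthogonal (by simp) horth h
      rw [this, smul_smul]
      have : ‖C (e i)‖ ≠ 0 := by simpa using h
      simp [this]
  let V := e.equiv b (Equiv.refl _)
  have h := scale_many e (fun i => ‖C (e i)‖) (fun i => norm_nonneg _)
    (fun i => (hC _).trans_eq (e.norm_eq_one i)) Finset.univ
    (g := g ∘ V) (hg.comp V.continuous) (hconv.comp_linearMap V.toLinearEquiv.toLinearMap)
  have h' : ∫ θ, (g ∘ V) θ ∂uniformSphere k = _ := uS_integral_comp g V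
  rw [h'] at h
  refine le_trans (le_of_eq ?_) h
  congr 1
  ext θ
  simp only [Function.comp]
  congr 1
  conv_lhs => rw [← e.sum_repr' θ, map_sum]
  conv_rhs => 
    arg 2
    arg 1
    rw [← e.sum_repr' θ]
  rw [← Finset.sum_sub_distrib, map_sum]
  refine Finset.sum_congr rfl fun i _ => ?_
  have hV : V (e i) = b i := by simp [V]
  rw [map_smul, map_sub, map_smul, map_smul, hV]
  conv_lhs => rw [hb i]
  module

theorem suppFn_cont {k : ℕ} {S : Set (EuclideanSpace ℝ (Fin k))} (hS : IsCompact S) :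
    Continuous (suppFn S) :=
  hS.continuous_sSup (f := fun x a => ⟪a, x⟫) (by fun_prop)

theorem suppFn_smul {k : ℕ} (S : Set (EuclideanSpace ℝ (Fin k))) {c : ℝ} (hc : 0 ≤ c)
    (x : EuclideanSpace ℝ (Fin k)) : suppFn S (c • x) = c * suppFn S x := by
  unfold suppFn
  rw [← smul_eq_mul, ← Real.sSup_smul_of_nonneg hc, ← Set.image_smul, Set.image_image]
  simp [inner_smul_right]

theorem suppFn_convex {k : ℕ} {S : Set (EuclideanSpace ℝ (Fin k))} (hS : IsCompact S)
    (hne : S.Nonempty) : ConvexOn ℝ univ (suppFn S) := by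
  refine ⟨convex_univ, fun x _ y _ a b ha hb _ => ?_⟩
  have hbd : ∀ x, BddAbove ((fun a => ⟪a, x⟫) '' S) := fun x =>
    (hS.image (by fun_prop)).bddAbove
  refine csSup_le (hne.image _) ?_
  rintro _ ⟨z, hz, rfl⟩
  have h1 : ⟪z, x⟫ ≤ suppFn S x := le_csSup (hbd x) ⟨z, hz, rfl⟩
  have h2 : ⟪z, y⟫ ≤ suppFn S y := le_csSup (hbd y) ⟨z, hz, rfl⟩
  simp only [inner_add_right, inner_smul_right, smul_eq_mul]
  gcongr

theorem inner_T {k n : ℕ} (T : Matrix (Fin k) (Fin n) ℝ) (a : EuclideanSpace ℝ (Fin n))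
    (y : EuclideanSpace ℝ (Fin k)) :
    ⟪Matrix.toEuclideanLin T a, y⟫ = ⟪a, Matrix.toEuclideanLin Tᵀ y⟫ := by
  have := Matrix.toEuclideanLin_conjTranspose_eq_adjoint T
  rw [Matrix.conjTranspose_eq_transpose_of_trivial] at this
  rw [this, LinearMap.adjoint_inner_right]

theorem le_max {k n : ℕ} (T : Matrix (Fin k) (Fin n) ℝ) (x : EuclideanSpace ℝ (Fin n)) :
    ‖Matrix.toEuclideanLin T x‖ ≤ maxSingularValue T * ‖x‖ := by
  by_cases hx : x = 0
  · simp [hx]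
  have hx' : 0 < ‖x‖ := norm_pos_iff.mpr hx
  rw [← div_le_iff₀ hx']
  refine le_csSup ⟨‖(Matrix.toEuclideanLin T).toContinuousLinearMap‖, ?_⟩
    ⟨‖x‖⁻¹ • x, ?_, ?_⟩
  · rintro _ ⟨y, hy, rfl⟩
    simpa [hy] using (Matrix.toEuclideanLin T).toContinuousLinearMap.le_opNorm y
  · rw [norm_smul]; simp [hx'.ne']
  · rw [map_smul, norm_smul]; simp [div_eq_inv_mul]

theorem max_nonneg' {k n : ℕ} (T : Matrix (Fin k) (Fin n) ℝ) : 0 ≤ maxSingularValue T := by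
  apply Real.sSup_nonneg
  rintro _ ⟨y, hy, rfl⟩
  exact norm_nonneg _

theorem min_nonneg' {k n : ℕ} (T : Matrix (Fin k) (Fin n) ℝ) : 0 ≤ minSingularValue T := by
  apply Real.sInf_nonneg
  rintro _ ⟨y, hy, rfl⟩
  exact norm_nonneg _

theorem le_max_T {k n : ℕ} (T : Matrix (Fin k) (Fin n) ℝ) (y : EuclideanSpace ℝ (Fin k)) :
    ‖Matrix.toEuclideanLin Tᵀ y‖ ≤ maxSingularValue T * ‖y‖ := by
  by_cases h : Matrix.toEuclideanLin Tᵀ y = 0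
  · rw [h, norm_zero]; exact mul_nonneg (max_nonneg' T) (norm_nonneg _)
  have hp : 0 < ‖Matrix.toEuclideanLin Tᵀ y‖ := norm_pos_iff.mpr h
  refine le_of_mul_le_mul_left ?_ hp
  calc _ = ⟪Matrix.toEuclideanLin Tᵀ y, Matrix.toEuclideanLin Tᵀ y⟫ :=
        (real_inner_self_eq_norm_mul_norm _).symm
    _ = ⟪Matrix.toEuclideanLin T (Matrix.toEuclideanLin Tᵀ y), y⟫ := (inner_T _ _ _).symm
    _ ≤ ‖Matrix.toEuclideanLin T (Matrix.toEuclideanLin Tᵀ y)‖ * ‖y‖ := real_inner_le_norm _ _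
    _ ≤ (maxSingularValue T * ‖Matrix.toEuclideanLin Tᵀ y‖) * ‖y‖ := by
        gcongr; exact le_max _ _
    _ = _ := by ring

theorem min_le_T {k n : ℕ} (T : Matrix (Fin k) (Fin n) ℝ) (y : EuclideanSpace ℝ (Fin k)) :
    minSingularValue T * ‖y‖ ≤ ‖Matrix.toEuclideanLin Tᵀ y‖ := by
  by_cases hx : y = 0
  · simp [hx]
  have hx' : 0 < ‖y‖ := norm_pos_iff.mpr hx
  rw [← le_div_iff₀ hx']
  refine csInf_le ⟨0, ?_⟩ ⟨‖y‖⁻¹ • y, ?_, ?_⟩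
  · rintro _ ⟨y, hy, rfl⟩
    exact norm_nonneg _
  · rw [norm_smul]; simp [hx'.ne']
  · rw [map_smul, norm_smul]; simp [div_eq_inv_mul]

theorem main_aux (n k : ℕ) (A : Set (EuclideanSpace ℝ (Fin n)))
    (hAc : IsCompact A) (hne : A.Nonempty) (T : Matrix (Fin k) (Fin n) ℝ) (m : ℕ) (hm : m = k)
    (e : EuclideanSpace ℝ (Fin m) ≃ₗᵢ[ℝ] LinearMap.range (Matrix.toEuclideanLin Tᵀ)) :
    minSingularValue T * ∫ θ, suppFn A (e θ) ∂uniformSphere m ≤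
      meanWidth (⇑(Matrix.toEuclideanLin T) '' A) ∧
    meanWidth (⇑(Matrix.toEuclideanLin T) '' A) ≤
      maxSingularValue T * ∫ θ, suppFn A (e θ) ∂uniformSphere m := by
  subst hm
  let ι : EuclideanSpace ℝ (Fin m) →ₗ[ℝ] EuclideanSpace ℝ (Fin n) :=
    (LinearMap.range (Matrix.toEuclideanLin Tᵀ)).subtype ∘ₗ e.toLinearEquiv.toLinearMap
  let S : EuclideanSpace ℝ (Fin m) →ₗ[ℝ] EuclideanSpace ℝ (Fin m) :=
    e.symm.toLinearEquiv.toLinearMap ∘ₗ (Matrix.toEuclideanLin Tᵀ).rangeRestrict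
  have hιS : ∀ x, ι (S x) = Matrix.toEuclideanLin Tᵀ x := by intro x; simp [ι, S]
  have hιn : ∀ x, ‖ι x‖ = ‖x‖ := by intro x; exact e.norm_map x
  have hSsurj : Function.Surjective S :=
    e.symm.surjective.comp (LinearMap.surjective_rangeRestrict _)
  let E := LinearEquiv.ofBijective S ⟨LinearMap.injective_iff_surjective.mpr hSsurj, hSsurj⟩
  have hSE : ∀ x, S (E.symm x) = x := fun x => E.apply_symm_apply x
  have hSn : ∀ x, ‖S x‖ = ‖Matrix.toEuclideanLin Tᵀ x‖ := by intro x; rw [← hιn, hιS]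
  have hw : meanWidth (⇑(Matrix.toEuclideanLin T) '' A)
      = ∫ θ, suppFn A (ι (S θ)) ∂uniformSphere m := by
    unfold meanWidth
    congr 1
    ext θ
    unfold suppFn
    rw [Set.image_image, hιS]
    simp only [inner_T]
  change _ * ∫ θ, suppFn A (ι θ) ∂uniformSphere m ≤ _ ∧
    _ ≤ _ * ∫ θ, suppFn A (ι θ) ∂uniformSphere m
  rw [hw, ← integral_const_mul, ← integral_const_mul]
  have hg := suppFn_cont hAc
  have hc := suppFn_convex hAc hne
  constructor
  · have := contraction (g := suppFn A ∘ (ι ∘ₗ S))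
      (hg.comp (LinearMap.continuous_of_finiteDimensional _)) (hc.comp_linearMap (ι ∘ₗ S))
      (minSingularValue T • E.symm.toLinearMap) (by
        intro x
        have h := min_le_T T (E.symm x)
        rw [← hSn, hSE] at h
        simpa [norm_smul, abs_of_nonneg (min_nonneg' T)] using h)
    refine le_trans (le_of_eq ?_) this
    congr 1
    ext θ
    simp only [Function.comp, LinearMap.comp_apply, LinearMap.smul_apply, map_smul,
      LinearEquiv.coe_coe, hSE]
    rw [suppFn_smul _ (min_nonneg' T)]
  · have := contraction (g := fun x => maxSingularValue T * suppFn A (ι x))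
      (continuous_const.mul (hg.comp (LinearMap.continuous_of_finiteDimensional _)))
      ((hc.comp_linearMap ι).smul (max_nonneg' T))
      ((maxSingularValue T)⁻¹ • S) (by
        intro x
        rw [LinearMap.smul_apply, norm_smul, hSn, norm_inv,
          Real.norm_of_nonneg (max_nonneg' T)]
        rcases (max_nonneg' T).eq_or_lt with h | h
        · simp [← h]
        · rw [inv_mul_le_iff₀ h]
          exact le_max_T T x)
    refine le_trans (le_of_eq ?_) this
    congr 1
    ext θ
    rw [← suppFn_smul _ (max_nonneg' T), LinearMap.smul_apply, map_smul, smul_smul]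
    rcases (max_nonneg' T).eq_or_lt with h | h
    · have h0 := le_max_T T θ
      rw [← h, zero_mul, norm_le_zero_iff, ← hιS] at h0
      rw [h0, smul_zero]
    · rw [mul_inv_cancel₀ h.ne', one_smul]

/-- For a symmetric convex body `A ⊆ ℝⁿ` and a `k × n` matrix `T` of
rank `k` with row space `F = Im(T*)`:
`s_k(T) w(P_F A) ≤ w(TA) ≤ s₁(T) w(P_F A)`. -/
theorem mean_width_image_vs_projection
    (n k : ℕ) (hk : 1 ≤ k) (hkn : k ≤ n)
    (A : Set (EuclideanSpace ℝ (Fin n)))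
    (hAc : IsCompact A) (hAconv : Convex ℝ A) (hAsymm : A = -A)
    (hAint : (interior A).Nonempty)
    (T : Matrix (Fin k) (Fin n) ℝ) (hrank : T.rank = k) :
    minSingularValue T *
        subsphereAvg (LinearMap.range (Matrix.toEuclideanLin Tᵀ)) (suppFn A) ≤
      meanWidth (⇑(Matrix.toEuclideanLin T) '' A) ∧
    meanWidth (⇑(Matrix.toEuclideanLin T) '' A) ≤
      maxSingularValue T *
        subsphereAvg (LinearMap.range (Matrix.toEuclideanLin Tᵀ)) (suppFn A) := by
  refine main_aux n k A hAc (hAint.mono interior_subset) T _ ?_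
    (stdOrthonormalBasis ℝ (LinearMap.range (Matrix.toEuclideanLin Tᵀ))).repr.symm
  rw [← Matrix.rank_transpose, Matrix.rank_eq_finrank_range_toLin Tᵀ
    (EuclideanSpace.basisFun (Fin n) ℝ).toBasis (EuclideanSpace.basisFun (Fin k) ℝ).toBasis] at hrank
  rwa [Matrix.toEuclideanLin_eq_toLin_orthonormal]
end
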